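/- Let k be an algebraically closed field of characteristic p > 0, let W(k) be its ring of p-typical Witt vectors, let K be the fraction field of W(k), and let σ : K → K be the field automorphism induced by the Witt-vector Frobenius (which is a ring automorphism of W(k) since k is perfect). Let V be a finite-dimensional K-vector space and let φ : V → V be a bijective additive map that is σ-semilinear, i.e. φ(λ·v) = σ(λ)·φ(v) for all λ ∈ K and v ∈ V. Then the additive map φ − p·id : V → V is surjective. -/

import Mathlib

open Finset in
theorem aux_W (p : ℕ) [Fact p.Prime] (k : Type) [Field k] [CharP k p] [IsAlgClosed k]
    (a : ℕ → WittVector p k) (n : ℕ) (ha : ∃ j ∈ range (n + 1), (a j).coeff 0 ≠ 0)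
    (d : WittVector p k) :
    ∃ y, ∑ j ∈ range (n + 1), a j * ((WittVector.frobenius : WittVector p k →+* _) ^ j) y = d := by
  classical
  let F : WittVector p k →+* WittVector p k := WittVector.frobenius
  let L : WittVector p k →+ WittVector p k :=
    ∑ j ∈ range (n + 1), (AddMonoidHom.mulLeft (a j)).comp (F ^ j).toAddMonoidHom
  have hL : ∀ y, L y = ∑ j ∈ range (n + 1), a j * (F ^ j) y := by
    intro y
    simp [L, AddMonoidHom.finsetSum_apply]
  have hLp : ∀ (m : ℕ) y, L ((p : WittVector p k) ^ m * y) = (p : WittVector p k) ^ m * L y := by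
    intro m y
    rw [hL, hL, mul_sum]
    refine sum_congr rfl fun j _ => ?_
    rw [map_mul, map_pow, map_natCast]
    ring
  have hFc : ∀ (j : ℕ) (y : WittVector p k), ((F ^ j) y).coeff 0 = y.coeff 0 ^ p ^ j := by
    intro j y
    rw [RingHom.coe_pow]
    exact WittVector.iterate_frobenius_coeff y j 0
  have step : ∀ d : WittVector p k, ∃ y e, d = L y + p * e := by
    intro d
    obtain ⟨j, hj, haj⟩ := ha
    let P : Polynomial k := ∑ j ∈ range (n + 1),
      Polynomial.C ((a j).coeff 0) * Polynomial.X ^ (p ^ j) - Polynomial.C (d.coeff 0)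
    have hp1 : 1 < p := (Fact.out : p.Prime).one_lt
    have hPc : P.coeff (p ^ j) ≠ 0 := by
      have h0 : p ^ j ≠ 0 := pow_ne_zero _ (by omega)
      simp only [P, Polynomial.coeff_sub, Polynomial.finsetSum_coeff, Polynomial.coeff_C_mul,
        Polynomial.coeff_X_pow, Polynomial.coeff_C, h0, if_false, sub_zero]
      rw [sum_eq_single j]
      · simpa using haj
      · intro i _ hij
        rw [if_neg, mul_zero]
        intro h
        exact hij (Nat.pow_right_injective hp1 h).symm
      · intro h; exact absurd hj h
    have hdeg : P.degree ≠ 0 := by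
      intro h
      have := Polynomial.le_degree_of_ne_zero hPc
      rw [h] at this
      have h2 : p ^ j ≤ 0 := by exact_mod_cast this
      have := pow_pos (show 0 < p by omega) j
      omega
    obtain ⟨x, hx⟩ := IsAlgClosed.exists_root P hdeg
    have hx' : ∑ j ∈ range (n + 1), (a j).coeff 0 * x ^ (p ^ j) = d.coeff 0 := by
      have := hx
      simp only [P, Polynomial.IsRoot.def, Polynomial.eval_sub, Polynomial.eval_finsetSum,
        Polynomial.eval_mul, Polynomial.eval_C, Polynomial.eval_pow, Polynomial.eval_X] at this
      exact sub_eq_zero.mp this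
    refine ⟨WittVector.teichmuller p x, ?_⟩
    have : d - L (WittVector.teichmuller p x) ∈ Ideal.span {(p : WittVector p k)} := by
      rw [WittVector.mem_span_p_iff_coeff_zero_eq_zero]
      rw [← WittVector.constantCoeff_apply, map_sub, hL, map_sum]
      simp only [map_mul, WittVector.constantCoeff_apply, hFc,
        WittVector.teichmuller_coeff_zero]
      rw [hx', sub_self]
    rw [Ideal.mem_span_singleton] at this
    obtain ⟨e, he⟩ := this
    exact ⟨e, by rw [← he]; ring⟩
  choose f g hfg using step
  let S : ℕ → WittVector p k := fun m => ∑ i ∈ range m, (p : WittVector p k) ^ i * f (g^[i] d)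
  have hS : ∀ m, d = L (S m) + (p : WittVector p k) ^ m * g^[m] d := by
    intro m
    induction m with
    | zero => simp [S]
    | succ m ih =>
      have h1 : S (m + 1) = S m + (p : WittVector p k) ^ m * f (g^[m] d) := sum_range_succ _ _
      rw [h1, map_add, hLp, Function.iterate_succ_apply']
      have h2 := hfg (g^[m] d)
      calc d = _ := ih
        _ = L (S m) + (p : WittVector p k) ^ m * (L (f (g^[m] d)) + p * g (g^[m] d)) := by rw [← h2]
        _ = _ := by ring
  let I := Ideal.span {(p : WittVector p k)}
  have hI : IsAdicComplete I (WittVector p k) := WittVector.isAdicCompleteIdealSpanP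
  have hpow : ∀ (m : ℕ) (x y : WittVector p k),
      x ≡ y [SMOD (I ^ m • ⊤ : Submodule (WittVector p k) (WittVector p k))] ↔
        (p : WittVector p k) ^ m ∣ x - y := by
    intro m x y
    rw [SModEq.sub_mem, smul_eq_mul, Ideal.mul_top, Ideal.span_singleton_pow,
      Ideal.mem_span_singleton]
  obtain ⟨y, hy⟩ := IsPrecomplete.prec hI.toIsPrecomplete (f := S) (by
    intro m m' hm
    rw [hpow]
    rw [← neg_sub, dvd_neg]
    simp only [S]
    rw [← sum_Ico_eq_sub _ hm]
    refine dvd_sum fun i hi => ?_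
    exact Dvd.dvd.mul_right (pow_dvd_pow _ (mem_Ico.mp hi).1) _)
  refine ⟨y, ?_⟩
  change ∑ j ∈ range (n + 1), a j * (F ^ j) y = d
  rw [← hL, ← sub_eq_zero]
  refine IsHausdorff.haus hI.toIsHausdorff _ fun m => ?_
  rw [hpow, sub_zero]
  obtain ⟨z, hz⟩ := (hpow _ _ _).mp (hy m)
  have : y = S m - (p : WittVector p k) ^ m * z := by rw [← hz]; ring
  refine ⟨- L z - g^[m] d, ?_⟩
  rw [this, map_sub, hLp]
  linear_combination -hS m

theorem aux_norm {R : Type*} [CommRing R] (q : R) (s : Finset ℕ) (N : ℕ) : ∀ a : ℕ → R,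
    (∃ j ∈ s, ¬ q ^ (N + 1) ∣ a j) →
    ∃ (m : ℕ) (b : ℕ → R), (∀ j ∈ s, a j = q ^ m * b j) ∧ ∃ j ∈ s, ¬ q ∣ b j := by
  induction N with
  | zero =>
    rintro a h
    exact ⟨0, a, by simp, by simpa using h⟩
  | succ N ih =>
    rintro a ⟨j, hj, h⟩
    by_cases h0 : ∃ j ∈ s, ¬ q ∣ a j
    · exact ⟨0, a, by simp, h0⟩
    · push Not at h0
      choose! c hc using h0
      obtain ⟨m, b, h1, h2⟩ := ih c ⟨j, hj, fun h' => h (by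
        rw [hc j hj, pow_succ']; exact mul_dvd_mul_left q h')⟩
      refine ⟨m + 1, b, fun i hi => ?_, h2⟩
      rw [hc i hi, h1 i hi]; ring

open Finset in
theorem aux_K (p : ℕ) [Fact p.Prime] (k : Type) [Field k] [CharP k p] [IsAlgClosed k]
    (σ : FractionRing (WittVector p k) →+* FractionRing (WittVector p k))
    (hσ : ∀ x : WittVector p k,
      σ (algebraMap (WittVector p k) (FractionRing (WittVector p k)) x)
        = algebraMap (WittVector p k) (FractionRing (WittVector p k))
            (WittVector.frobenius x))
    (e : ℕ → FractionRing (WittVector p k)) (n : ℕ) (he : ∃ j ∈ range (n + 1), e j ≠ 0)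
    (d : FractionRing (WittVector p k)) :
    ∃ y, ∑ j ∈ range (n + 1), e j * (σ ^ j) y = d := by
  classical
  let A := algebraMap (WittVector p k) (FractionRing (WittVector p k))
  have hA : Function.Injective A := IsFractionRing.injective _ _
  have hp0 : (p : FractionRing (WittVector p k)) ≠ 0 := WittVector.FractionRing.p_nonzero p k
  have hσj : ∀ (j : ℕ) x, (σ ^ j) (A x) =
      A (((WittVector.frobenius : WittVector p k →+* _) ^ j) x) := by
    intro j x
    induction j with
    | zero => simp
    | succ j ih =>
      rw [pow_succ', pow_succ', RingHom.mul_def, RingHom.mul_def, RingHom.comp_apply,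
        RingHom.comp_apply, ih]
      exact hσ _
  obtain ⟨b, hb⟩ := IsLocalization.exist_integer_multiples (nonZeroDivisors (WittVector p k))
    (range (n + 1)) e
  choose! a ha using hb
  have hb0 : A (b : WittVector p k) ≠ 0 := by
    rw [Ne, map_eq_zero_iff A hA]
    exact nonZeroDivisors.ne_zero b.2
  have ha' : ∀ j ∈ range (n + 1), A (a j) = A b * e j := by
    intro j hj
    rw [show A (a j) = _ from ha j hj, Algebra.smul_def]
  obtain ⟨j, hj, hej⟩ := he
  have haj : a j ≠ 0 := by
    intro h
    have := ha' j hj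
    rw [h, map_zero] at this
    exact (mul_ne_zero hb0 hej) this.symm
  obtain ⟨N, u, hu⟩ := WittVector.exists_eq_pow_p_mul' (a j) haj
  have hpn : ¬ (p : WittVector p k) ^ (N + 1) ∣ a j := by
    rw [hu, pow_succ]
    intro h
    have h2 := (mul_dvd_mul_iff_left (pow_ne_zero N (WittVector.p_nonzero p k))).mp h
    exact (WittVector.irreducible p).not_isUnit (isUnit_of_dvd_unit h2 u.isUnit)
  obtain ⟨m, c, hc, i, hi, hci⟩ := aux_norm (p : WittVector p k) (range (n + 1)) N a ⟨j, hj, hpn⟩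
  have hci' : (c i).coeff 0 ≠ 0 := by
    rwa [Ne, ← WittVector.mem_span_p_iff_coeff_zero_eq_zero, Ideal.mem_span_singleton]
  obtain ⟨⟨r, s⟩, hrs⟩ := IsLocalization.surj (nonZeroDivisors (WittVector p k))
    (A b * ((p : FractionRing (WittVector p k)) ^ m)⁻¹ * d)
  obtain ⟨t, v, hv⟩ := WittVector.exists_eq_pow_p_mul' (s : WittVector p k)
    (nonZeroDivisors.ne_zero s.2)
  obtain ⟨y, hy⟩ := aux_W p k c n ⟨i, hi, hci'⟩ (r * (v⁻¹ : (WittVector p k)ˣ))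
  refine ⟨((p : FractionRing (WittVector p k)) ^ t)⁻¹ * A y, ?_⟩
  have hvv : A v * A (v⁻¹ : (WittVector p k)ˣ) = 1 := by rw [← map_mul]; simp
  have hpm := pow_ne_zero m hp0
  have hpt := pow_ne_zero t hp0
  have hej' : ∀ j ∈ range (n + 1), e j = (A b)⁻¹ * (p : FractionRing (WittVector p k)) ^ m * A (c j) := by
    intro j hj
    have := ha' j hj
    rw [hc j hj, map_mul, map_pow, map_natCast] at this
    rw [mul_assoc, this]
    field_simp
  have hsum : ∑ j ∈ range (n + 1), e j * (σ ^ j) (((p : FractionRing (WittVector p k)) ^ t)⁻¹ * A y)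
      = (A b)⁻¹ * (p : FractionRing (WittVector p k)) ^ m *
        ((p : FractionRing (WittVector p k)) ^ t)⁻¹ * A (r * (v⁻¹ : (WittVector p k)ˣ)) := by
    rw [← hy, map_sum, mul_sum]
    refine sum_congr rfl fun j hj => ?_
    rw [hej' j hj, map_mul, map_inv₀, map_pow, map_natCast, hσj, map_mul]
    ring
  rw [hsum, map_mul]
  have h1 : A b * ((p : FractionRing (WittVector p k)) ^ m)⁻¹ * d *
      ((p : FractionRing (WittVector p k)) ^ t * A v) = A r := by
    have : A (s : WittVector p k) = (p : FractionRing (WittVector p k)) ^ t * A v := by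
      rw [hv, map_mul, map_pow, map_natCast]
    rw [← this]; exact hrs
  rw [← h1]
  generalize A (v⁻¹ : (WittVector p k)ˣ) = v' at hvv ⊢
  field_simp
  linear_combination d * hvv

open Finset in
theorem aux_V {K V : Type*} [Field K] [AddCommGroup V] [Module K V] [FiniteDimensional K V]
    (σ : K →+* K) (hK : ∀ (e : ℕ → K) (n : ℕ), (∃ j ∈ range (n + 1), e j ≠ 0) → ∀ d,
      ∃ y, ∑ j ∈ range (n + 1), e j * (σ ^ j) y = d)
    (ψ : V →ₛₗ[σ] V) (w : V) : ∃ v, ψ v - v = w := by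
  classical
  obtain ⟨n, c, hc, hn⟩ : ∃ (n : ℕ) (c : ℕ → K), (∃ j ∈ range (n + 1), c j ≠ 0) ∧
      ∑ j ∈ range (n + 1), c j • ψ^[j] w = 0 := by
    let n := Module.finrank K V
    have h : ¬ LinearIndependent K (fun i : Fin (n + 1) => ψ^[i] w) := by
      intro h
      have := h.fintype_card_le_finrank
      simp [n] at this
    rw [Fintype.not_linearIndependent_iff] at h
    obtain ⟨g, hg, i, hi⟩ := h
    refine ⟨n, fun j => if h : j < n + 1 then g ⟨j, h⟩ else 0, ⟨i, mem_range.mpr i.2, ?_⟩, ?_⟩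
    · beta_reduce
      rw [dif_pos i.2]
      exact hi
    · rw [← hg, sum_range]
      refine sum_congr rfl fun j _ => ?_
      beta_reduce
      rw [dif_pos j.2]
  obtain ⟨y, hy⟩ := hK (fun j => (σ ^ j) (c (n - j))) n (by
    obtain ⟨j, hj, h⟩ := hc
    rw [mem_range] at hj
    refine ⟨n - j, by simp, ?_⟩
    rw [Ne, map_eq_zero, Nat.sub_sub_self (by omega)]
    exact h) (-1)
  let x : ℕ → K := fun i => Nat.rec (-1 - y * c 0) (fun i z => σ z - y * c (i + 1)) i
  have hx0 : x 0 = -1 - y * c 0 := rfl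
  have hxs : ∀ i, x (i + 1) = σ (x i) - y * c (i + 1) := fun i => rfl
  have hx : ∀ i, x i = -1 - ∑ j ∈ range (i + 1), (σ ^ (i - j)) (y * c j) := by
    intro i
    induction i with
    | zero => simp [hx0]
    | succ i ih =>
      rw [hxs, ih, sum_range_succ _ (i + 1), map_sub, map_neg, map_one, map_sum]
      have : ∀ j ∈ range (i + 1), σ ((σ ^ (i - j)) (y * c j)) = (σ ^ (i + 1 - j)) (y * c j) := by
        intro j hj
        rw [mem_range] at hj
        rw [show i + 1 - j = (i - j) + 1 by omega, pow_succ']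
        rfl
      rw [sum_congr rfl this]
      simp
      ring
  have hxn : x n = 0 := by
    rw [hx, ← sum_range_reflect]
    have : ∀ j ∈ range (n + 1), (σ ^ (n - (n + 1 - 1 - j))) (y * c (n + 1 - 1 - j)) =
        (σ ^ j) (c (n - j)) * (σ ^ j) y := by
      intro j hj
      rw [mem_range] at hj
      rw [show n - (n + 1 - 1 - j) = j by omega, map_mul, mul_comm]
      rfl
    rw [sum_congr rfl this, hy]
    ring
  have key : ∀ m, ψ (∑ i ∈ range m, x i • ψ^[i] w) - ∑ i ∈ range m, x i • ψ^[i] w =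
      w + y • ∑ j ∈ range (m + 1), c j • ψ^[j] w + x m • ψ^[m] w := by
    intro m
    induction m with
    | zero =>
      simp [hx0]
      module
    | succ m ih =>
      rw [sum_range_succ, map_add, sum_range_succ _ (m + 1), map_smulₛₗ, hxs,
        ← Function.iterate_succ_apply' ψ]
      have := eq_add_of_sub_eq ih
      rw [this]
      module
  refine ⟨∑ i ∈ range n, x i • ψ^[i] w, ?_⟩
  rw [key, hn, hxn]
  simp


/-- Let `k` be an algebraically closed field of characteristic `p > 0`, `W(k)` its ring
of `p`-typical Witt vectors, `K = Frac(W(k))`, and `σ : K ≃+* K` the automorphism induced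
by the Witt-vector Frobenius.  If `V` is a finite-dimensional `K`-vector space and
`φ : V → V` is a bijective additive `σ`-semilinear map, then `φ - p·id` is surjective. -/
theorem phi_sub_p_surjective (p : ℕ) [Fact p.Prime] (k : Type) [Field k]
    [CharP k p] [IsAlgClosed k]
    (σ : FractionRing (WittVector p k) ≃+* FractionRing (WittVector p k))
    (hσ : ∀ x : WittVector p k,
      σ (algebraMap (WittVector p k) (FractionRing (WittVector p k)) x)
        = algebraMap (WittVector p k) (FractionRing (WittVector p k))
            (WittVector.frobenius x))
    (V : Type) [AddCommGroup V] [Module (FractionRing (WittVector p k)) V]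
    [FiniteDimensional (FractionRing (WittVector p k)) V]
    (φ : V →ₛₗ[(σ : FractionRing (WittVector p k) →+* FractionRing (WittVector p k))] V)
    (hφ : Function.Bijective φ) :
    Function.Surjective
      (fun v : V => φ v - (p : FractionRing (WittVector p k)) • v) := by
  intro w
  have hp0 : (p : FractionRing (WittVector p k)) ≠ 0 := WittVector.FractionRing.p_nonzero p k
  obtain ⟨v, hv⟩ := aux_V (σ : FractionRing (WittVector p k) →+* FractionRing (WittVector p k))
    (fun e n he d => aux_K p k _ hσ e n he d)
    ((p : FractionRing (WittVector p k))⁻¹ • φ) ((p : FractionRing (WittVector p k))⁻¹ • w)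
  refine ⟨v, ?_⟩
  have h := congrArg (fun z => (p : FractionRing (WittVector p k)) • z) hv
  simpa [smul_sub, smul_smul, hp0] using h
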